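/- For every probability mass function p on ℕ and every x ≥ 0, σ²(x) ≤ ∑_{j : p_j x ≤ 1} (p_j x)² + ∑_{j : p_j x > 1} p_j x. -/

import Mathlib

open Real

noncomputable def vF (p : ℕ → ℝ) (x : ℝ) : ℝ :=
  ∑' j, Real.exp (-(p j) * x) * (1 - Real.exp (-(p j) * x))

noncomputable def uF (p : ℕ → ℝ) (x : ℝ) : ℝ :=
  ∑' j, p j * x * Real.exp (-(p j) * x)

/-- `σ²(x) = v(x) − u(x)²/x` for `x > 0`; for `x = 0` this formula also gives
`σ²(0) = 0`. -/
noncomputable def sigma2F (p : ℕ → ℝ) (x : ℝ) : ℝ := vF p x - (uF p x) ^ 2 / x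

lemma exp_neg_mul_one_sub_sub_le {a : ℝ} (ha : 0 ≤ a) :
    exp (-a) * (1 - exp (-a)) - 2 * (a * exp (-a)) + a ≤ if a ≤ 1 then a ^ 2 else a := by
  have h1 : 1 ≤ exp (-a) + a := by linarith [add_one_le_exp (-a)]
  have h0 := exp_pos (-a)
  split_ifs
  · nlinarith [mul_nonneg (sub_nonneg.2 h1) (by positivity : 0 ≤ exp (-a) + a)]
  · nlinarith [mul_nonneg h0.le (sub_nonneg.2 h1), mul_nonneg ha h0.le]

lemma two_mul_sub_le_sq_div {u x : ℝ} (hx : 0 < x) : 2 * u - x ≤ u ^ 2 / x := by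
  rw [le_div_iff₀ hx]
  nlinarith [sq_nonneg (u - x)]

/-- Lemma 4.2, upper bound:
`σ²(x) ≤ ∑_{p_j x ≤ 1} (p_j x)² + ∑_{p_j x > 1} p_j x`. -/
theorem sigma2_upper (p : ℕ → ℝ) (hp0 : ∀ j, 0 ≤ p j) (hp1 : (∑' j, p j) = 1)
    (x : ℝ) (hx : 0 ≤ x) :
    sigma2F p x ≤ ∑' j, if p j * x ≤ 1 then (p j * x) ^ 2 else p j * x := by
  obtain rfl | hx := hx.eq_or_lt
  · simp [sigma2F, vF]
  have hp : Summable p := by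
    by_contra h
    simp [tsum_eq_zero_of_not_summable h] at hp1
  have ha0 (j) : 0 ≤ p j * x := mul_nonneg (hp0 j) hx.le
  have ha : Summable fun j ↦ p j * x := hp.mul_right x
  have hsum : ∑' j, p j * x = x := by rw [tsum_mul_right, hp1, one_mul]
  have hexp (j) : exp (-(p j * x)) ≤ 1 := exp_le_one_iff.2 (neg_nonpos.2 (ha0 j))
  have hv : Summable fun j ↦ exp (-(p j * x)) * (1 - exp (-(p j * x))) := by
    refine ha.of_nonneg_of_le
      (fun j ↦ mul_nonneg (exp_pos _).le (sub_nonneg.2 (hexp j))) fun j ↦ ?_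
    calc exp (-(p j * x)) * (1 - exp (-(p j * x)))
      _ ≤ 1 - exp (-(p j * x)) := mul_le_of_le_one_left (sub_nonneg.2 (hexp j)) (hexp j)
      _ ≤ p j * x := by linarith [add_one_le_exp (-(p j * x))]
  have hu : Summable fun j ↦ p j * x * exp (-(p j * x)) :=
    ha.of_nonneg_of_le (fun j ↦ mul_nonneg (ha0 j) (exp_pos _).le)
      fun j ↦ mul_le_of_le_one_right (ha0 j) (hexp j)
  have hg : Summable fun j ↦ if p j * x ≤ 1 then (p j * x) ^ 2 else p j * x := by
    refine ha.of_nonneg_of_le (fun j ↦ ?_) fun j ↦ ?_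
    · split_ifs
      exacts [sq_nonneg _, ha0 j]
    · split_ifs with h
      exacts [by nlinarith [ha0 j], le_rfl]
  calc sigma2F p x
    _ ≤ vF p x - 2 * uF p x + x := by
      rw [sigma2F]
      linarith [two_mul_sub_le_sq_div (u := uF p x) hx]
    _ = ∑' j, (exp (-(p j * x)) * (1 - exp (-(p j * x)))
          - 2 * (p j * x * exp (-(p j * x))) + p j * x) := by
      rw [(hv.sub (hu.mul_left 2)).tsum_add ha, hv.tsum_sub (hu.mul_left 2), tsum_mul_left, hsum]
      simp only [vF, uF, neg_mul]
    _ ≤ _ := ((hv.sub (hu.mul_left 2)).add ha).tsum_le_tsum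
      (fun j ↦ exp_neg_mul_one_sub_sub_le (ha0 j)) hg
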